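/- Consider the closed-loop bittide dynamics θ'(t) = A·θ(t) + ω^u + q + r with A an irreducible rate matrix having positive left null vector z (z > 0 entrywise, z^T A = 0, 1^T z = 1) and spectral projector W = 1·z^T. If r lies in the range of A and q = 0, then the frequency ω(t) = θ'(t) converges as t → ∞ to W·ω^u = 1·(z^T ω^u); in particular all components of the limit are equal to the weighted average z^T ω^u of the uncontrolled frequencies. -/

import Mathlib

open Matrix Filter

/-- A matrix is Metzler if all its off-diagonal entries are nonnegative. -/
def IsMetzler {n : ℕ} (Q : Matrix (Fin n) (Fin n) ℝ) : Prop :=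
  ∀ i j, i ≠ j → 0 ≤ Q i j

/-- A rate matrix is a Metzler matrix whose rows each sum to zero. -/
def IsRateMatrix {n : ℕ} (Q : Matrix (Fin n) (Fin n) ℝ) : Prop :=
  IsMetzler Q ∧ Q *ᵥ (fun _ => (1 : ℝ)) = 0

/-- A matrix is irreducible if the directed graph with an edge `i → j` whenever
`i ≠ j` and `Q i j ≠ 0` is strongly connected. -/
def IsIrreducibleMatrix {n : ℕ} (Q : Matrix (Fin n) (Fin n) ℝ) : Prop :=
  ∀ i j : Fin n, i ≠ j → Relation.TransGen (fun a b => a ≠ b ∧ Q a b ≠ 0) i j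

/-- The Dirichlet form of `A` weighted by `z`. -/
def weightedDirichletForm {n : ℕ} (A : Matrix (Fin n) (Fin n) ℝ) (z e : Fin n → ℝ) : ℝ :=
  ∑ i, ∑ j, z i * A i j * (e i - e j) ^ 2

theorem weightedDirichletForm_eq {n : ℕ} {A : Matrix (Fin n) (Fin n) ℝ}
    (hA : A *ᵥ (fun _ => (1 : ℝ)) = 0) {z : Fin n → ℝ} (hz : z ᵥ* A = 0) (e : Fin n → ℝ) :
    weightedDirichletForm A z e = -(2 * ∑ i, z i * e i * (A *ᵥ e) i) := by
  have hrow (i : Fin n) : ∑ j, A i j = 0 := by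
    simpa [mulVec, dotProduct] using congrFun hA i
  have hcol (j : Fin n) : ∑ i, z i * A i j = 0 := by
    simpa [vecMul, dotProduct] using congrFun hz j
  have h₁ : ∑ i, ∑ j, z i * e i ^ 2 * A i j = 0 := by
    simp [← Finset.mul_sum, hrow]
  have h₂ : ∑ i, ∑ j, z i * A i j * e j ^ 2 = 0 := by
    rw [Finset.sum_comm]
    simp [← Finset.sum_mul, hcol]
  have h₃ : ∑ i, z i * e i * (A *ᵥ e) i = ∑ i, ∑ j, z i * e i * (A i j * e j) := by
    simp [mulVec, dotProduct, Finset.mul_sum]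
  have h₄ : weightedDirichletForm A z e = ∑ i, ∑ j, z i * e i ^ 2 * A i j
      + ∑ i, ∑ j, z i * A i j * e j ^ 2 - 2 * ∑ i, ∑ j, z i * e i * (A i j * e j) := by
    simp only [weightedDirichletForm, Finset.mul_sum, ← Finset.sum_add_distrib,
      ← Finset.sum_sub_distrib]
    exact Finset.sum_congr rfl fun i _ => Finset.sum_congr rfl fun j _ => by ring
  rw [h₄, h₁, h₂, h₃]
  ring

theorem IsMetzler.weightedDirichletForm_term_nonneg {n : ℕ} {A : Matrix (Fin n) (Fin n) ℝ}
    (hA : IsMetzler A) {z : Fin n → ℝ} (hz : ∀ i, 0 < z i) (e : Fin n → ℝ) (i j : Fin n) :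
    0 ≤ z i * A i j * (e i - e j) ^ 2 := by
  rcases eq_or_ne i j with rfl | hij
  · simp
  · exact mul_nonneg (mul_nonneg (hz i).le (hA i j hij)) (sq_nonneg _)

theorem IsMetzler.weightedDirichletForm_nonneg {n : ℕ} {A : Matrix (Fin n) (Fin n) ℝ}
    (hA : IsMetzler A) {z : Fin n → ℝ} (hz : ∀ i, 0 < z i) (e : Fin n → ℝ) :
    0 ≤ weightedDirichletForm A z e :=
  Finset.sum_nonneg fun i _ => Finset.sum_nonneg fun j _ =>
    hA.weightedDirichletForm_term_nonneg hz e i j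

theorem eq_of_weightedDirichletForm_eq_zero {n : ℕ} {A : Matrix (Fin n) (Fin n) ℝ}
    (hA : IsMetzler A) (hirr : IsIrreducibleMatrix A) {z : Fin n → ℝ} (hz : ∀ i, 0 < z i)
    {e : Fin n → ℝ} (he : weightedDirichletForm A z e = 0) (i j : Fin n) : e i = e j := by
  have hedge (a b : Fin n) (hab : a ≠ b ∧ A a b ≠ 0) : e a = e b := by
    have h₁ := (Finset.sum_eq_zero_iff_of_nonneg fun i _ => Finset.sum_nonneg fun j _ =>
      hA.weightedDirichletForm_term_nonneg hz e i j).1 he a (Finset.mem_univ a)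
    have h₂ := (Finset.sum_eq_zero_iff_of_nonneg fun j _ =>
      hA.weightedDirichletForm_term_nonneg hz e a j).1 h₁ b (Finset.mem_univ b)
    simpa [(hz a).ne', hab.2, sub_eq_zero] using h₂
  rcases eq_or_ne i j with rfl | hij
  · rfl
  · have h := hirr i j hij
    induction h with
    | single h => exact hedge _ _ h
    | tail _ h ih =>
      rename_i b _ _
      by_cases hb : i = b
      · subst hb; exact hedge _ _ h
      · exact (ih hb).trans (hedge _ _ h)

/-- Poincaré inequality for the weighted Dirichlet form on vectors of weighted mean zero. -/
theorem exists_weightedDirichletForm_ge {n : ℕ} {A : Matrix (Fin n) (Fin n) ℝ}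
    (hA : IsMetzler A) (hirr : IsIrreducibleMatrix A) {z : Fin n → ℝ} (hz : ∀ i, 0 < z i)
    (hz_sum : ∑ i, z i = 1) :
    ∃ c > 0, ∀ e : Fin n → ℝ, z ⬝ᵥ e = 0 →
      c * ∑ i, z i * e i ^ 2 ≤ weightedDirichletForm A z e := by
  have hV (e : Fin n → ℝ) : ∑ i, z i * e i ^ 2 ≤ ‖e‖ ^ 2 := by
    calc ∑ i, z i * e i ^ 2 ≤ ∑ i, z i * ‖e‖ ^ 2 := by
          refine Finset.sum_le_sum fun i _ => mul_le_mul_of_nonneg_left ?_ (hz i).le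
          exact sq_le_sq' (neg_le_of_abs_le (norm_le_pi_norm e i))
            (le_of_abs_le (norm_le_pi_norm e i))
      _ = ‖e‖ ^ 2 := by rw [← Finset.sum_mul, hz_sum, one_mul]
  have hcont : Continuous (weightedDirichletForm A z) := by
    unfold weightedDirichletForm
    fun_prop
  let K : Set (Fin n → ℝ) := Metric.sphere 0 1 ∩ {e | z ⬝ᵥ e = 0}
  have hK : IsCompact K := by
    refine (isCompact_sphere 0 1).inter_right (isClosed_eq ?_ continuous_const)
    unfold dotProduct
    fun_prop
  obtain ⟨c, hc, hcK⟩ : ∃ c > 0, ∀ e ∈ K, c ≤ weightedDirichletForm A z e := by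
    rcases K.eq_empty_or_nonempty with h | h
    · exact ⟨1, one_pos, by simp [h]⟩
    · obtain ⟨e, he, hmin⟩ := hK.exists_isMinOn h hcont.continuousOn
      refine ⟨_, (hA.weightedDirichletForm_nonneg hz e).lt_of_ne' fun h0 => ?_, hmin⟩
      have hconst := eq_of_weightedDirichletForm_eq_zero hA hirr hz h0
      have he0 : e = 0 := by
        funext i
        have h₁ : z ⬝ᵥ e = e i := by
          simp only [dotProduct, hconst _ i, ← Finset.sum_mul, hz_sum, one_mul]
        exact h₁.symm.trans he.2
      have h₂ := he.1
      simp [he0] at h₂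
  refine ⟨c, hc, fun e he => (mul_le_mul_of_nonneg_left (hV e) hc.le).trans ?_⟩
  rcases eq_or_ne e 0 with rfl | hne
  · simp [weightedDirichletForm]
  have hpos : 0 < ‖e‖ := norm_pos_iff.2 hne
  have hmem : ‖e‖⁻¹ • e ∈ K := by
    refine ⟨by simp [norm_smul, hpos.ne'], ?_⟩
    simp [he]
  have hscale : weightedDirichletForm A z (‖e‖⁻¹ • e)
      = (‖e‖ ^ 2)⁻¹ * weightedDirichletForm A z e := by
    simp only [weightedDirichletForm, Finset.mul_sum, Pi.smul_apply, smul_eq_mul]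
    exact Finset.sum_congr rfl fun i _ => Finset.sum_congr rfl fun j _ => by ring
  have h := hcK _ hmem
  rw [hscale, inv_mul_eq_div, le_div_iff₀ (by positivity)] at h
  exact h

theorem tendsto_zero_of_hasDerivAt_le {V V' : ℝ → ℝ} {c : ℝ} (hc : 0 < c)
    (hV : ∀ t, 0 ≤ t → HasDerivAt V (V' t) t) (hle : ∀ t, 0 ≤ t → V' t ≤ -(c * V t))
    (hnonneg : ∀ t, 0 ≤ V t) : Tendsto V atTop (nhds 0) := by
  have hder (t : ℝ) (ht : 0 ≤ t) : HasDerivAt (fun s => V s * Real.exp (c * s))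
      (V' t * Real.exp (c * t) + V t * (Real.exp (c * t) * c)) t := by
    have h : HasDerivAt (fun s => c * s) c t := by simpa using (hasDerivAt_id t).const_mul c
    exact (hV t ht).mul h.exp
  have hanti : AntitoneOn (fun s => V s * Real.exp (c * s)) (Set.Ici 0) := by
    refine antitoneOn_of_hasDerivWithinAt_nonpos (convex_Ici 0)
      (fun t ht => (hder t ht).continuousAt.continuousWithinAt)
      (fun t ht => (hder t (interior_subset ht)).hasDerivWithinAt) fun t ht => ?_
    nlinarith [hle t (interior_subset ht), Real.exp_pos (c * t)]
  have hbound (t : ℝ) (ht : 0 ≤ t) : V t ≤ V 0 * Real.exp (-(c * t)) := by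
    have h := hanti (Set.mem_Ici.2 le_rfl) ht ht
    rw [Real.exp_neg, ← div_eq_mul_inv, le_div_iff₀ (Real.exp_pos _)]
    simpa using h
  have hlim : Tendsto (fun t => V 0 * Real.exp (-(c * t))) atTop (nhds 0) := by
    simpa using (Real.tendsto_exp_neg_atTop_nhds_zero.comp
      (tendsto_id.const_mul_atTop hc)).const_mul (V 0)
  exact tendsto_of_tendsto_of_tendsto_of_le_of_le' tendsto_const_nhds hlim
    (Eventually.of_forall hnonneg) ((eventually_ge_atTop 0).mono hbound)

/-- Solutions of `e' = A e` with weighted mean zero decay to zero. -/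
theorem tendsto_zero_of_hasDerivAt_mulVec {n : ℕ} {A : Matrix (Fin n) (Fin n) ℝ}
    (hrate : IsRateMatrix A) (hirr : IsIrreducibleMatrix A) {z : Fin n → ℝ}
    (hz_pos : ∀ i, 0 < z i) (hz_left : z ᵥ* A = 0) (hz_sum : ∑ i, z i = 1)
    {e : ℝ → Fin n → ℝ} (he : ∀ t, 0 ≤ t → HasDerivAt e (A *ᵥ e t) t)
    (hmean : ∀ t, z ⬝ᵥ e t = 0) : Tendsto e atTop (nhds 0) := by
  obtain ⟨c, hc, hcD⟩ := exists_weightedDirichletForm_ge hrate.1 hirr hz_pos hz_sum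
  have hterm (t : ℝ) (i : Fin n) : 0 ≤ z i * e t i ^ 2 :=
    mul_nonneg (hz_pos i).le (sq_nonneg _)
  have hV : Tendsto (fun t => ∑ i, z i * e t i ^ 2) atTop (nhds 0) := by
    refine tendsto_zero_of_hasDerivAt_le (V' := fun t => -weightedDirichletForm A z (e t)) hc
      (fun t ht => ?_) (fun t _ => neg_le_neg (hcD _ (hmean t)))
      fun t => Finset.sum_nonneg fun i _ => hterm t i
    have h := HasDerivAt.fun_sum (u := Finset.univ) fun i _ =>
      (((hasDerivAt_pi.1 (he t ht)) i).fun_pow 2).const_mul (z i)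
    refine h.congr_deriv ?_
    rw [weightedDirichletForm_eq hrate.2 hz_left, neg_neg, Finset.mul_sum]
    exact Finset.sum_congr rfl fun i _ => by simp; ring
  refine tendsto_pi_nhds.2 fun i => ?_
  have hsq : Tendsto (fun t => z i * e t i ^ 2) atTop (nhds 0) :=
    squeeze_zero (fun t => hterm t i) (fun t => Finset.single_le_sum
      (f := fun i => z i * e t i ^ 2) (fun j _ => hterm t j) (Finset.mem_univ i)) hV
  have hsquare : Tendsto (fun t => e t i ^ 2) atTop (nhds 0) := by
    simpa [(hz_pos i).ne'] using hsq.const_mul (z i)⁻¹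
  rw [Pi.zero_apply, tendsto_zero_iff_abs_tendsto_zero]
  simpa [Real.sqrt_sq_eq_abs, Function.comp_def] using hsquare.sqrt

/-- Closed-loop bittide dynamics `θ'(t) = A θ(t) + ωᵘ + q + r`, with `A` an
irreducible rate matrix with positive left null vector `z` and spectral
projector `W = 1·zᵀ`.  If `r ∈ range A` and `q = 0`, then the frequency
`ω(t) = θ'(t)` converges to `W ωᵘ`, all of whose components equal the
weighted average `zᵀ ωᵘ`. -/
theorem frequency_tendsto_weighted_average {n : ℕ} (A : Matrix (Fin n) (Fin n) ℝ)
    (hrate : IsRateMatrix A) (hirr : IsIrreducibleMatrix A)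
    (z : Fin n → ℝ) (hz_pos : ∀ i, 0 < z i)
    (hz_left : z ᵥ* A = 0) (hz_sum : ∑ i, z i = 1)
    (W : Matrix (Fin n) (Fin n) ℝ) (hW : W = vecMulVec (fun _ => (1 : ℝ)) z)
    (ωu q r : Fin n → ℝ) (hq : q = 0) (hr : ∃ x : Fin n → ℝ, A *ᵥ x = r)
    (θ : ℝ → Fin n → ℝ)
    (hθ : ∀ t : ℝ, 0 ≤ t → HasDerivAt θ (A *ᵥ θ t + ωu + q + r) t) :
    Tendsto (fun t : ℝ => A *ᵥ θ t + ωu + q + r) atTop (nhds (W *ᵥ ωu)) ∧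
      W *ᵥ ωu = fun _ => z ⬝ᵥ ωu := by
  subst hW hq
  obtain ⟨x, rfl⟩ := hr
  have hW (v : Fin n → ℝ) : vecMulVec (fun _ => (1 : ℝ)) z *ᵥ v = fun _ : Fin n => z ⬝ᵥ v := by
    funext i
    simp [mulVec, vecMulVec_apply, dotProduct]
  refine ⟨?_, hW ωu⟩
  rw [hW]
  have hzA (v : Fin n → ℝ) : z ⬝ᵥ A *ᵥ v = 0 := by
    rw [dotProduct_mulVec, hz_left, zero_dotProduct]
  have hA_const (a : ℝ) : A *ᵥ (fun _ => a) = 0 := by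
    have h : (fun _ : Fin n => a) = a • fun _ => (1 : ℝ) := by
      funext i
      simp
    rw [h, mulVec_smul, hrate.2, smul_zero]
  let ω : ℝ → Fin n → ℝ := fun t => A *ᵥ θ t + ωu + 0 + A *ᵥ x
  have hdecay : Tendsto (fun t => ω t - fun _ => z ⬝ᵥ ωu) atTop (nhds 0) := by
    refine tendsto_zero_of_hasDerivAt_mulVec hrate hirr hz_pos hz_left hz_sum
      (fun t ht => ?_) fun t => ?_
    · rw [mulVec_sub, hA_const, sub_zero]
      have hlin := (LinearMap.toContinuousLinearMap A.mulVecLin).hasFDerivAt.comp_hasDerivAt t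
        (hθ t ht)
      exact (((hlin.add_const ωu).add_const 0).add_const (A *ᵥ x)).sub_const _
    · have hmean : z ⬝ᵥ (fun _ => z ⬝ᵥ ωu) = z ⬝ᵥ ωu := by
        rw [dotProduct, ← Finset.sum_mul, hz_sum, one_mul]
      simp [ω, dotProduct_sub, dotProduct_add, hzA, hmean]
  simpa [ω] using hdecay.add_const (fun _ : Fin n => z ⬝ᵥ ωu)
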